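/- Let H be a non-ordinary numerical set. Then T(T(H)) = {x − m(H) : x ∈ H ∪ {F(H)}, x ≠ 0}, and consequently A(T(T(H))) = A*(H ∪ {F(H)}). -/

import Mathlib

open scoped Classical

/-- A numerical set: a subset of ℕ containing 0 with finite complement. -/
def NumericalSet (H : Set ℕ) : Prop := 0 ∈ H ∧ Hᶜ.Finite

/-- A numerical semigroup: a numerical set closed under addition. -/
def NumericalSemigroup (S : Set ℕ) : Prop :=
  NumericalSet S ∧ ∀ a ∈ S, ∀ b ∈ S, a + b ∈ S

/-- Frobenius number: the largest gap. -/
noncomputable def frob (H : Set ℕ) : ℕ := sSup Hᶜ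

/-- Genus: the number of gaps. -/
noncomputable def genus (H : Set ℕ) : ℕ := Hᶜ.ncard

/-- Multiplicity: the smallest nonzero element. -/
noncomputable def mult (H : Set ℕ) : ℕ := sInf {x | x ∈ H ∧ x ≠ 0}

/-- The T-set of a numerical set.  (With truncated subtraction, every `x ≥ frob H`
satisfies `frob H - x = 0`, matching the convention that `F(H) - x` computed in ℤ
is nonpositive, hence not a nonzero element of `H`.) -/
def Tset (H : Set ℕ) : Set ℕ := {x | frob H - x ∉ H ∨ frob H - x = 0}

/-- The associated numerical semigroup of a numerical set. -/
def A (H : Set ℕ) : Set ℕ := {x | ∀ h ∈ H, x + h ∈ H}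

/-- `A*`-operation on numerical sets. -/
def Astar (H : Set ℕ) : Set ℕ := {a | ∀ h ∈ H, h ≠ 0 → a + h ∈ H}

/-- Pseudo-Frobenius numbers of a numerical set. -/
def PF (H : Set ℕ) : Set ℕ := {a | a ∉ H ∧ ∀ h ∈ H, h ≠ 0 → a + h ∈ H}

/-- Type of a numerical set. -/
noncomputable def typ (H : Set ℕ) : ℕ := (PF H).ncard

/-- Almost symmetric: `t(S) = 2 g(S) - F(S)`. -/
def AlmostSymmetric (S : Set ℕ) : Prop :=
  (typ S : ℤ) = 2 * (genus S : ℤ) - (frob S : ℤ)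

/-- An ordinary numerical set: `{0} ∪ {x : x > F(H)}`. -/
def Ordinary (H : Set ℕ) : Prop := H = insert 0 {x : ℕ | frob H < x}

theorem NumericalSet.mem_of_frob_lt {H : Set ℕ} (hH : NumericalSet H) {x : ℕ}
    (hx : frob H < x) : x ∈ H := by
  by_contra hxH
  exact (le_csSup hH.2.bddAbove hxH).not_gt hx

theorem frob_eq_of_isGreatest {H : Set ℕ} {f : ℕ} (h : IsGreatest Hᶜ f) : frob H = f :=
  h.csSup_eq

theorem mult_le {H : Set ℕ} {x : ℕ} (hx : x ∈ H) (h0 : x ≠ 0) : mult H ≤ x :=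
  Nat.sInf_le ⟨hx, h0⟩

theorem NumericalSet.mult_mem {H : Set ℕ} (hH : NumericalSet H) : mult H ∈ H ∧ mult H ≠ 0 :=
  Nat.sInf_mem (s := {x | x ∈ H ∧ x ≠ 0})
    ⟨frob H + 1, hH.mem_of_frob_lt (Nat.lt_succ_self _), Nat.succ_ne_zero _⟩

theorem NumericalSet.frob_notMem {H : Set ℕ} (hH : NumericalSet H) (hord : ¬ Ordinary H) :
    frob H ∉ H := by
  refine Nat.sSup_mem (s := Hᶜ) ?_ hH.2.bddAbove
  by_contra hne
  have hU : Hᶜ = ∅ := Set.not_nonempty_iff_eq_empty.mp hne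
  refine hord ?_
  have hf : frob H = 0 := by simp [frob, hU]
  rw [Ordinary, hf, Set.compl_empty_iff.mp hU]
  ext x
  simp only [Set.mem_univ, Set.mem_insert_iff, Set.mem_ofPred_eq, true_iff]
  omega

theorem NumericalSet.mult_lt_frob {H : Set ℕ} (hH : NumericalSet H) (hord : ¬ Ordinary H) :
    mult H < frob H := by
  by_contra! hle
  refine hord (Set.ext fun x => ⟨fun hx => ?_, ?_⟩)
  · rcases eq_or_ne x 0 with h0 | h0
    · exact Or.inl h0
    · refine Or.inr (lt_of_le_of_ne (hle.trans (mult_le hx h0)) ?_)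
      rintro rfl
      exact hH.frob_notMem hord hx
  · rintro (rfl | hx)
    exacts [hH.1, hH.mem_of_frob_lt hx]

theorem NumericalSet.frob_Tset {H : Set ℕ} (hH : NumericalSet H) (hord : ¬ Ordinary H) :
    frob (Tset H) = frob H - mult H := by
  have hlt := hH.mult_lt_frob hord
  obtain ⟨hm, hm0⟩ := hH.mult_mem
  refine frob_eq_of_isGreatest ⟨?_, fun x hx => ?_⟩
  · have h : frob H - (frob H - mult H) = mult H := by omega
    simp [Tset, h, hm, hm0]
  · simp only [Tset, Set.mem_compl_iff, Set.mem_ofPred_eq, not_or, not_not] at hx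
    have := mult_le hx.1 hx.2
    omega

theorem NumericalSet.mem_Tset_Tset {H : Set ℕ} (hH : NumericalSet H) (hord : ¬ Ordinary H)
    {x : ℕ} : x ∈ Tset (Tset H) ↔ x + mult H ∈ H ∪ {frob H} := by
  have hlt := hH.mult_lt_frob hord
  obtain ⟨-, hm0⟩ := hH.mult_mem
  rw [Tset, Set.mem_ofPred_eq, hH.frob_Tset hord]
  rcases lt_trichotomy (x + mult H) (frob H) with h | h | h
  · have hx : frob H - (frob H - mult H - x) = x + mult H := by omega
    have h1 : frob H - mult H - x ≠ 0 := by omega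
    have h2 : x + mult H ≠ 0 := by omega
    simp only [Tset, Set.mem_ofPred_eq, hx, h1, h2, or_false, not_not, Set.mem_union,
      Set.mem_singleton_iff, h.ne]
  · exact iff_of_true (Or.inr (by omega)) (Or.inr h)
  · exact iff_of_true (Or.inr (by omega)) (Or.inl (hH.mem_of_frob_lt h))

theorem stmt_11 (H : Set ℕ) (hH : NumericalSet H) (hord : ¬ Ordinary H) :
    Tset (Tset H) = (fun x => x - mult H) '' ((H ∪ {frob H}) \ {0}) ∧
    A (Tset (Tset H)) = Astar (H ∪ {frob H}) := by
  obtain ⟨-, hm0⟩ := hH.mult_mem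
  have hle : ∀ y ∈ H ∪ {frob H}, y ≠ 0 → mult H ≤ y := by
    rintro y (hy | rfl) h0
    exacts [mult_le hy h0, (hH.mult_lt_frob hord).le]
  constructor
  · ext x
    rw [hH.mem_Tset_Tset hord]
    constructor
    · exact fun hx => ⟨x + mult H, ⟨hx, by simp [hm0]⟩, Nat.add_sub_cancel _ _⟩
    · rintro ⟨y, ⟨hy, h0⟩, rfl⟩
      simpa [Nat.sub_add_cancel (hle y hy h0)] using hy
  · ext a
    simp only [A, Astar, Set.mem_ofPred_eq, hH.mem_Tset_Tset hord]
    constructor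
    · intro ha h hh h0
      have hs := Nat.sub_add_cancel (hle h hh h0)
      have := ha (h - mult H) (by rwa [hs])
      rwa [add_assoc, hs] at this
    · intro ha h hh
      rw [add_assoc]
      exact ha _ hh (by omega)
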